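/- Let H be a separable infinite-dimensional real Hilbert space, 0 < t ≤ 1, and let ρ : O₊(B) → O₊(B) be a group homomorphism admitting a ρ-equivariant map f : ℋ(H) → ℋ(H) with B(f(x), f(y)) = (B(x,y))^t for all x,y. Then ρ is non-elementary: (1) there is no point q ∈ ℋ(H) with ρ(g)·q = q for all g ∈ O₊(B); (2) there is no nonzero isotropic vector ξ ∈ ℝ × H (B(ξ,ξ) = 0) such that for every g ∈ O₊(B) there is λ ∈ ℝ with ρ(g)(ξ) = λ·ξ; and (3) there is no two-dimensional linear subspace P ⊆ ℝ × H meeting ℋ(H) (i.e. a geodesic line) with ρ(g)(P) = P for all g ∈ O₊(B). -/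

import Mathlib

open scoped RealInnerProductSpace

variable (H : Type*) [NormedAddCommGroup H] [InnerProductSpace ℝ H]

/-- The Minkowski bilinear form on `ℝ × H`. -/
noncomputable def minkB (v w : ℝ × H) : ℝ := v.1 * w.1 - ⟪v.2, w.2⟫

/-- The hyperboloid model of hyperbolic space inside `ℝ × H`. -/
noncomputable def Hyp : Set (ℝ × H) := {v | minkB H v v = 1 ∧ 0 < v.1}

/-- Inverse hyperbolic cosine. -/
noncomputable def arcosh (x : ℝ) : ℝ := Real.log (x + Real.sqrt (x ^ 2 - 1))

/-- The hyperbolic distance on the hyperboloid. -/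
noncomputable def hypDist (x y : ℝ × H) : ℝ := arcosh (minkB H x y)

/-- A subset of the hyperboloid is hyperbolically total if its closed linear span
is all of `ℝ × H`. -/
def HypTotal (S : Set (ℝ × H)) : Prop :=
  (Submodule.span ℝ S).topologicalClosure = ⊤

/-- A kernel of hyperbolic type. -/
def IsHypKernel {X : Type*} (β : X → X → ℝ) : Prop :=
  (∀ x y, β x y = β y x) ∧ (∀ x y, 0 ≤ β x y) ∧ (∀ x, β x x = 1) ∧
    ∀ (n : ℕ) (x₀ : X) (x : Fin n → X) (c : Fin n → ℝ),
      ∑ i, ∑ j, c i * c j * β (x i) (x j) ≤ (∑ k, c k * β (x k) x₀) ^ 2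

/-- A kernel of conditionally negative type. -/
def IsCNDKernel {X : Type*} (ψ : X → X → ℝ) : Prop :=
  (∀ x y, ψ x y = ψ y x) ∧ (∀ x, ψ x x = 0) ∧
    ∀ (n : ℕ) (x : Fin n → X) (c : Fin n → ℝ), (∑ i, c i = 0) →
      ∑ i, ∑ j, c i * c j * ψ (x i) (x j) ≤ 0

/-- The group `O₊(B)` of continuous linear automorphisms of `ℝ × H` preserving the
Minkowski form and the upper hyperboloid sheet. -/
noncomputable def Oplus : Subgroup ((ℝ × H) ≃L[ℝ] (ℝ × H)) where
  carrier := {g | (∀ v w, minkB H (g v) (g w) = minkB H v w) ∧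
    ∀ v, v ∈ Hyp H ↔ g v ∈ Hyp H}
  one_mem' := ⟨fun _ _ => rfl, fun _ => Iff.rfl⟩
  mul_mem' := by
    rintro a b ⟨ha1, ha2⟩ ⟨hb1, hb2⟩
    refine ⟨fun v w => ?_, fun v => ?_⟩
    · show minkB H (a (b v)) (a (b w)) = _
      rw [ha1, hb1]
    · show v ∈ Hyp H ↔ a (b v) ∈ Hyp H
      rw [← ha2, ← hb2]
  inv_mem' := by
    rintro a ⟨ha1, ha2⟩
    refine ⟨fun v w => ?_, fun v => ?_⟩
    · show minkB H (a.symm v) (a.symm w) = minkB H v w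
      conv_rhs => rw [← a.apply_symm_apply v, ← a.apply_symm_apply w, ha1]
    · show v ∈ Hyp H ↔ a.symm v ∈ Hyp H
      conv_lhs => rw [← a.apply_symm_apply v, ← ha2]


section Minkowski

variable {H}

lemma minkB_comm (v w : ℝ × H) : minkB H v w = minkB H w v := by
  simp only [minkB, real_inner_comm w.2 v.2, mul_comm]

lemma minkB_add_left (u v w : ℝ × H) : minkB H (u + v) w = minkB H u w + minkB H v w := by
  simp only [minkB, Prod.fst_add, Prod.snd_add, inner_add_left]; ring

lemma minkB_sub_left (u v w : ℝ × H) : minkB H (u - v) w = minkB H u w - minkB H v w := by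
  simp only [minkB, Prod.fst_sub, Prod.snd_sub, inner_sub_left]; ring

lemma minkB_smul_left (c : ℝ) (v w : ℝ × H) : minkB H (c • v) w = c * minkB H v w := by
  simp only [minkB, Prod.smul_fst, Prod.smul_snd, real_inner_smul_left, smul_eq_mul]; ring

lemma minkB_add_right (u v w : ℝ × H) : minkB H u (v + w) = minkB H u v + minkB H u w := by
  simp only [minkB_comm u, minkB_add_left]

lemma minkB_sub_right (u v w : ℝ × H) : minkB H u (v - w) = minkB H u v - minkB H u w := by
  simp only [minkB_comm u, minkB_sub_left]

lemma minkB_smul_right (c : ℝ) (v w : ℝ × H) : minkB H v (c • w) = c * minkB H v w := by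
  simp only [minkB_comm v, minkB_smul_left]

/-- The Minkowski pairing with a fixed vector, as a continuous linear functional. -/
noncomputable def minkBRight (u : ℝ × H) : (ℝ × H) →L[ℝ] ℝ :=
  u.1 • ContinuousLinearMap.fst ℝ ℝ H - (innerSL ℝ u.2).comp (ContinuousLinearMap.snd ℝ ℝ H)

@[simp] lemma minkBRight_apply (u w : ℝ × H) : minkBRight u w = minkB H w u := by
  simp [minkBRight, minkB, mul_comm, real_inner_comm]

/-- The reversed Cauchy-Schwarz dichotomy: a vector orthogonal to a nonzero causal vector is
not timelike. -/
lemma minkB_self_nonpos {v q : ℝ × H} (hq : q ≠ 0) (hqq : 0 ≤ minkB H q q)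
    (h : minkB H v q = 0) : minkB H v v ≤ 0 := by
  simp only [minkB, real_inner_self_eq_norm_sq] at *
  have hcs := abs_real_inner_le_norm v.2 q.2
  rw [show ⟪v.2, q.2⟫ = v.1 * q.1 by linarith] at hcs
  have hsq : (v.1 * q.1) ^ 2 ≤ (‖v.2‖ * ‖q.2‖) ^ 2 := by
    rw [← sq_abs]; exact pow_le_pow_left₀ (abs_nonneg _) hcs 2
  have hq1 : q.1 ≠ 0 := by
    intro h0
    apply hq
    have : ‖q.2‖ = 0 := by
      rw [h0] at hqq
      nlinarith [sq_nonneg ‖q.2‖]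
    exact Prod.ext h0 (norm_eq_zero.1 this)
  have hpos : 0 < q.1 ^ 2 := by positivity
  have := mul_nonneg (sq_nonneg ‖v.2‖) hqq
  by_contra! hc
  nlinarith [mul_pos hc hpos]

/-- A nonzero vector orthogonal to a point of the hyperboloid is spacelike. -/
lemma minkB_self_neg {v q : ℝ × H} (hq : q ∈ Hyp H) (hv : v ≠ 0)
    (h : minkB H v q = 0) : minkB H v v < 0 := by
  by_contra! hc
  have := minkB_self_nonpos hv hc (by rw [minkB_comm]; exact h : minkB H q v = 0)
  linarith [hq.1]

lemma minkB_pos_iff {v m : ℝ × H} (hv : minkB H v v = 1) (hm : m ∈ Hyp H) :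
    0 < minkB H v m ↔ 0 < v.1 := by
  obtain ⟨hm, hm1⟩ := hm
  simp only [minkB, real_inner_self_eq_norm_sq] at *
  have hcs := abs_le.1 (abs_real_inner_le_norm v.2 m.2)
  have h1 : ‖v.2‖ * ‖m.2‖ < |v.1 * m.1| := by
    apply lt_of_pow_lt_pow_left₀ 2 (abs_nonneg _)
    rw [sq_abs]
    nlinarith [sq_nonneg ‖v.2‖, sq_nonneg ‖m.2‖]
  constructor
  · intro h
    by_contra! hc
    have := mul_nonneg (neg_nonneg.2 hc) hm1.le
    rw [abs_of_nonpos (by linarith)] at h1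
    linarith
  · intro h
    rw [abs_of_pos (mul_pos h hm1)] at h1
    linarith

lemma one_le_minkB {x y : ℝ × H} (hx : x ∈ Hyp H) (hy : y ∈ Hyp H) : 1 ≤ minkB H x y := by
  have hpos := (minkB_pos_iff hx.1 hy).2 hx.2
  have h := minkB_self_nonpos (v := x - minkB H x y • y) (q := y)
    (by rintro rfl; exact hy.2.ne' rfl) (by rw [hy.1]; norm_num)
    (by rw [minkB_sub_left, minkB_smul_left, hy.1]; ring)
  simp only [minkB_sub_left, minkB_sub_right, minkB_smul_left, minkB_smul_right, hx.1, hy.1,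
    minkB_comm y x] at h
  nlinarith

/-- A form-preserving automorphism fixing a point of the hyperboloid lies in `Oplus`. -/
lemma mem_Oplus_of_fixed {g : (ℝ × H) ≃L[ℝ] (ℝ × H)}
    (hg : ∀ v w, minkB H (g v) (g w) = minkB H v w) {m : ℝ × H} (hm : m ∈ Hyp H)
    (hgm : g m = m) : g ∈ Oplus H := by
  refine ⟨hg, fun v => ?_⟩
  have key : minkB H (g v) m = minkB H v m := by conv_lhs => rw [← hgm, hg]
  simp only [Hyp, Set.mem_ofPred_eq, hg]
  refine and_congr_right fun hv => ?_
  rw [← minkB_pos_iff hv hm, ← minkB_pos_iff ((hg v v).trans hv) hm, key]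

/-- The quarter turn in the plane of two orthogonal spacelike vectors `u`, `v` of
square `-N`, extended by the identity on the orthogonal complement. -/
noncomputable def quarterTurn (u v : ℝ × H) (N : ℝ) : (ℝ × H) →L[ℝ] (ℝ × H) :=
  ContinuousLinearMap.id ℝ _ + N⁻¹ • ((minkBRight u).smulRight (u - v) +
    (minkBRight v).smulRight (u + v))

lemma quarterTurn_apply (u v : ℝ × H) (N : ℝ) (w : ℝ × H) :
    quarterTurn u v N w =
      w + N⁻¹ • (minkB H w u • (u - v) + minkB H w v • (u + v)) := by
  simp [quarterTurn]

lemma minkB_quarterTurn {u v : ℝ × H} {N : ℝ} (hN : N ≠ 0) (hu : minkB H u u = -N)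
    (hv : minkB H v v = -N) (huv : minkB H u v = 0) (w z : ℝ × H) :
    minkB H (quarterTurn u v N w) (quarterTurn u v N z) = minkB H w z := by
  simp only [quarterTurn_apply, minkB_add_left, minkB_add_right, minkB_sub_left, minkB_sub_right,
    minkB_smul_left, minkB_smul_right, hu, hv, huv, minkB_comm v u, minkB_comm u z,
    minkB_comm v z]
  field_simp
  ring

lemma quarterTurn_neg_quarterTurn {u v : ℝ × H} {N : ℝ} (hN : N ≠ 0) (hu : minkB H u u = -N)
    (hv : minkB H v v = -N) (huv : minkB H u v = 0) (w : ℝ × H) :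
    quarterTurn u (-v) N (quarterTurn u v N w) = w := by
  have h (z : ℝ × H) : minkB H z (-v) = -minkB H z v := by
    simpa using minkB_smul_right (-1) z v
  simp only [quarterTurn_apply, minkB_add_left, minkB_sub_left,
    minkB_smul_left, h, hu, hv, huv, minkB_comm v u]
  match_scalars <;> field_simp <;> ring

lemma quarterTurn_quarterTurn {u v : ℝ × H} {N : ℝ} (hN : N ≠ 0) (hu : minkB H u u = -N)
    (hv : minkB H v v = -N) (huv : minkB H u v = 0) (w : ℝ × H) :
    quarterTurn u v N (quarterTurn u v N w) =
      w + (2 * N⁻¹) • (minkB H w u • u + minkB H w v • v) := by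
  simp only [quarterTurn_apply, minkB_add_left, minkB_sub_left,
    minkB_smul_left, hu, hv, huv, minkB_comm v u]
  match_scalars <;> field_simp <;> ring

lemma exists_unit_orthogonal_pair (hinf : ¬ FiniteDimensional ℝ H) (a b : H) :
    ∃ e : H, ‖e‖ = 1 ∧ ⟪a, e⟫ = 0 ∧ ⟪b, e⟫ = 0 := by
  let S : Submodule ℝ H := Submodule.span ℝ {a, b}
  have : FiniteDimensional ℝ S := FiniteDimensional.span_of_finite ℝ (by simp)
  have hS : Sᗮ ≠ ⊥ := by
    intro h
    rw [Submodule.orthogonal_eq_bot_iff] at h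
    rw [h] at this
    exact hinf (LinearEquiv.finiteDimensional (Submodule.topEquiv (R := ℝ) (M := H)))
  obtain ⟨z, hz, hz0⟩ := Submodule.exists_mem_ne_zero_of_ne_bot hS
  have hz' (c : H) (hc : c ∈ S) : ⟪c, z⟫ = 0 := hz c hc
  refine ⟨‖z‖⁻¹ • z, norm_smul_inv_norm hz0, ?_, ?_⟩
  · rw [real_inner_smul_right, hz' a (Submodule.subset_span (by simp)), mul_zero]
  · rw [real_inner_smul_right, hz' b (Submodule.subset_span (by simp)), mul_zero]

/-- Any two points of the hyperboloid are exchanged by the square of an isometry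
fixing a point. -/
lemma exists_sq_apply_eq (hinf : ¬ FiniteDimensional ℝ H) {x y : ℝ × H} (hx : x ∈ Hyp H)
    (hy : y ∈ Hyp H) :
    ∃ g : Oplus H, ∃ m ∈ Hyp H, g.1 m = m ∧ g.1 (g.1 x) = y := by
  by_cases hxy : x = y
  · exact ⟨1, x, hx, rfl, hxy⟩
  have hB := one_le_minkB hx hy
  set b := minkB H x y with hb
  have hyx : minkB H y x = b := minkB_comm y x
  obtain ⟨c, hc0, hc⟩ : ∃ c : ℝ, 0 < c ∧ c ^ 2 * (2 + 2 * b) = 1 := by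
    refine ⟨(√(2 + 2 * b))⁻¹, by positivity, ?_⟩
    rw [inv_pow, Real.sq_sqrt (by linarith), inv_mul_cancel₀ (by linarith)]
  have hm : c • (x + y) ∈ Hyp H := by
    refine ⟨?_, ?_⟩
    · simp only [minkB_smul_left, minkB_smul_right, minkB_add_left, minkB_add_right, hx.1, hy.1,
        hyx, ← hb]
      linarith
    · exact mul_pos hc0 (add_pos hx.2 hy.2)
  have hum : minkB H (x - y) (c • (x + y)) = 0 := by
    simp only [minkB_smul_right, minkB_sub_left, minkB_add_right, hx.1, hy.1, hyx, ← hb]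
    ring
  have hu := minkB_self_neg hm (sub_ne_zero.2 hxy) hum
  obtain ⟨N, hN⟩ : ∃ N, N = -minkB H (x - y) (x - y) := ⟨_, rfl⟩
  have hN0 : 0 < N := by linarith
  have hNb : N = 2 * b - 2 := by
    rw [hN]
    simp only [minkB_sub_left, minkB_sub_right, hx.1, hy.1, hyx, ← hb]
    ring
  obtain ⟨e, he, hxe, hye⟩ := exists_unit_orthogonal_pair hinf x.2 y.2
  let v : ℝ × H := (0, √N • e)
  have hxv : minkB H x v = 0 := by simp [minkB, v, real_inner_smul_right, hxe]
  have hyv : minkB H y v = 0 := by simp [minkB, v, real_inner_smul_right, hye]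
  have hvv : minkB H v v = -N := by
    simp [minkB, v, norm_smul, he, hN0.le]
  have hvv' : minkB H (-v) (-v) = -N := by simpa [minkB] using hvv
  have huu : minkB H (x - y) (x - y) = -N := by linarith
  have huv : minkB H (x - y) v = 0 := by rw [minkB_sub_left, hxv, hyv, sub_zero]
  have huv' : minkB H (x - y) (-v) = 0 := by
    rw [← neg_one_smul ℝ v, minkB_smul_right, huv, mul_zero]
  let g : (ℝ × H) ≃L[ℝ] (ℝ × H) :=
    ContinuousLinearEquiv.equivOfInverse (quarterTurn (x - y) v N) (quarterTurn (x - y) (-v) N)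
      (quarterTurn_neg_quarterTurn hN0.ne' huu hvv huv)
      (fun w => by
        simpa using quarterTurn_neg_quarterTurn hN0.ne' huu hvv' huv' w)
  have hgm : g (c • (x + y)) = c • (x + y) := by
    change quarterTurn (x - y) v N _ = _
    rw [quarterTurn_apply, minkB_comm _ (x - y), hum, minkB_smul_left, minkB_add_left, hxv, hyv]
    simp
  refine ⟨⟨g, mem_Oplus_of_fixed (minkB_quarterTurn hN0.ne' huu hvv huv) hm hgm⟩, _, hm, hgm, ?_⟩
  change quarterTurn (x - y) v N (quarterTurn (x - y) v N x) = y
  rw [quarterTurn_quarterTurn hN0.ne' huu hvv huv, hxv, minkB_sub_right, hx.1, ← hb, zero_smul,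
    add_zero, smul_smul, show 2 * N⁻¹ * (1 - b) = -1 by field_simp; linarith]
  simp

/-- The kernel of a nonzero functional on a plane is a line. -/
lemma exists_span_ker_of_finrank_eq_two {V : Type*} [AddCommGroup V] [Module ℝ V]
    (hV : Module.finrank ℝ V = 2) {l : V →ₗ[ℝ] ℝ} (hl : l ≠ 0) :
    ∃ w : V, w ≠ 0 ∧ l w = 0 ∧ ∀ z, l z = 0 → ∃ c : ℝ, z = c • w := by
  have : FiniteDimensional ℝ V := Module.finite_of_finrank_pos (by omega)
  have hker : Module.finrank ℝ (LinearMap.ker l) = 1 := by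
    have := LinearMap.finrank_range_add_finrank_ker l
    rw [LinearMap.range_eq_top.2 (LinearMap.surjective hl), finrank_top, Module.finrank_self,
      hV] at this
    omega
  obtain ⟨⟨w, hwl⟩, hw0, hw⟩ := finrank_eq_one_iff'.1 hker
  refine ⟨w, fun h => hw0 (Subtype.ext h), hwl, fun z hz => ?_⟩
  obtain ⟨c, hc⟩ := hw ⟨z, hz⟩
  exact ⟨c, (congrArg Subtype.val hc).symm⟩

/-- The square of a form-preserving map that stabilizes a plane meeting the hyperboloid and
fixes a point of the hyperboloid is the identity on that plane. -/
lemma apply_apply_eq_of_plane {T : (ℝ × H) →ₗ[ℝ] (ℝ × H)}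
    (hT : ∀ v w, minkB H (T v) (T w) = minkB H v w) {P : Submodule ℝ (ℝ × H)}
    (hP : Module.finrank ℝ P = 2) (hTP : ∀ v ∈ P, T v ∈ P) {n : ℝ × H} (hn : n ∈ Hyp H)
    (hTn : T n = n) {q : ℝ × H} (hqP : q ∈ P) (hq : q ∈ Hyp H) : T (T q) = q := by
  have hTn' (v : ℝ × H) : minkB H (T v) n = minkB H v n := by conv_lhs => rw [← hTn, hT]
  let l : P →ₗ[ℝ] ℝ := (minkBRight n).toLinearMap ∘ₗ P.subtype
  have hl (w : P) : l w = minkB H w n := minkBRight_apply n w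
  have hl0 : l ≠ 0 := fun h => by
    have h0 : minkB H q n = 0 := by rw [← hl ⟨q, hqP⟩, h]; rfl
    linarith [one_le_minkB hq hn]
  obtain ⟨⟨w, hwP⟩, hw0, hwl, hw⟩ := exists_span_ker_of_finrank_eq_two hP hl0
  have hspan (z : ℝ × H) (hz : z ∈ P) (hzn : minkB H z n = 0) : ∃ c : ℝ, z = c • w := by
    obtain ⟨c, hc⟩ := hw ⟨z, hz⟩ (by rw [hl]; exact hzn)
    exact ⟨c, congrArg Subtype.val hc⟩
  have hwn : minkB H w n = 0 := by rw [hl] at hwl; exact hwl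
  have hww : minkB H w w < 0 := minkB_self_neg hn (by rintro rfl; exact hw0 rfl) hwn
  obtain ⟨ε, hε⟩ := hspan (T w) (hTP w hwP) (by rw [hTn', hwn])
  have hε2 : ε * ε = 1 := by
    have := hT w w
    rw [hε, minkB_smul_left, minkB_smul_right] at this
    exact mul_right_cancel₀ hww.ne (by linarith)
  have hTTw : T (T w) = w := by rw [hε, map_smul, hε, smul_smul, hε2, one_smul]
  obtain ⟨c, hc⟩ := hspan (T (T q) - q) (P.sub_mem (hTP _ (hTP _ hqP)) hqP)
    (by rw [minkB_sub_left, hTn', hTn', sub_self])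
  have hcw : c * minkB H w w = 0 := by
    rw [← minkB_smul_left, ← hc, minkB_sub_left]
    nth_rewrite 1 [← hTTw]
    rw [hT, hT, sub_self]
  rw [(mul_eq_zero.1 hcw).resolve_right hww.ne, zero_smul] at hc
  exact sub_eq_zero.1 hc

/-- A map of the hyperboloid transforming the Minkowski form by a positive power does not take
its values in a single level set of a causal vector. -/
lemma exists_minkB_ne [Nontrivial H] {t : ℝ} (ht0 : 0 < t) {f : ℝ × H → ℝ × H}
    (hf : ∀ x ∈ Hyp H, f x ∈ Hyp H)
    (hpow : ∀ x ∈ Hyp H, ∀ y ∈ Hyp H, minkB H (f x) (f y) = (minkB H x y) ^ t)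
    {q : ℝ × H} (hq : q ≠ 0) (hqq : 0 ≤ minkB H q q) :
    ∃ x ∈ Hyp H, ∃ y ∈ Hyp H, minkB H (f x) q ≠ minkB H (f y) q := by
  by_contra! h
  obtain ⟨e, he⟩ := exists_norm_eq H zero_le_one
  obtain ⟨C, hC1, hCt⟩ : ∃ C : ℝ, 1 ≤ C ∧ C ^ t = 4 :=
    ⟨4 ^ t⁻¹, Real.one_le_rpow (by norm_num) (by positivity),
      Real.rpow_inv_rpow (by norm_num) ht0.ne'⟩
  have hS : √(C ^ 2 - 1) ^ 2 = C ^ 2 - 1 := Real.sq_sqrt (by nlinarith)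
  set S := √(C ^ 2 - 1)
  have hSe : ⟪S • e, S • e⟫ = C ^ 2 - 1 := by
    rw [real_inner_self_eq_norm_sq, norm_smul, he, mul_one, Real.norm_eq_abs, sq_abs, hS]
  have hm : ((1, 0) : ℝ × H) ∈ Hyp H := by simp [Hyp, minkB]
  have hx : ((C, S • e) : ℝ × H) ∈ Hyp H := by
    refine ⟨?_, by simp only; linarith⟩
    simp only [minkB, hSe]
    ring
  have hy : ((C, -(S • e)) : ℝ × H) ∈ Hyp H := by
    refine ⟨?_, by simp only; linarith⟩
    simp only [minkB, inner_neg_neg, hSe]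
    ring
  have hxm := hpow _ hx _ hm
  have hym := hpow _ hy _ hm
  have hxy := hpow _ hx _ hy
  rw [show minkB H ((C, S • e) : ℝ × H) (1, 0) = C by simp [minkB], hCt] at hxm
  rw [show minkB H ((C, -(S • e)) : ℝ × H) (1, 0) = C by simp [minkB], hCt] at hym
  have hlarge : (16 : ℝ) ≤ minkB H (f (C, S • e)) (f (C, -(S • e))) := by
    rw [hxy, show (16 : ℝ) = (C * C) ^ t by
      rw [Real.mul_rpow (by linarith) (by linarith), hCt]; norm_num]
    refine Real.rpow_le_rpow (by positivity) ?_ ht0.le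
    simp only [minkB, inner_neg_right, hSe]
    nlinarith
  have hneg := minkB_self_nonpos
    (v := f (C, S • e) + f (C, -(S • e)) - (2 : ℝ) • f (1, 0)) hq hqq (by
      rw [minkB_sub_left, minkB_add_left, minkB_smul_left, h _ hx _ hm, h _ hy _ hm]; ring)
  simp only [minkB_add_left, minkB_add_right, minkB_sub_left, minkB_sub_right, minkB_smul_left,
    minkB_smul_right, (hf _ hx).1, (hf _ hy).1, (hf _ hm).1, minkB_comm (f (1, 0)),
    minkB_comm (f (C, -(S • e))) (f (C, S • e)), hxm, hym] at hneg
  linarith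

end Minkowski

/-- the self-representation `ρ` admitting an equivariant map `f` with
`B (f x) (f y) = (B x y)ᵗ` is non-elementary: no fixed point in the hyperboloid, no
fixed point at infinity (isotropic line), and no invariant geodesic line. -/
theorem self_representation_nonelementary
    (H : Type*) [NormedAddCommGroup H] [InnerProductSpace ℝ H] [CompleteSpace H]
    [TopologicalSpace.SeparableSpace H] (hinf : ¬ FiniteDimensional ℝ H)
    (t : ℝ) (ht0 : 0 < t) (ht1 : t ≤ 1)
    (ρ : Oplus H →* Oplus H) (f : ℝ × H → ℝ × H)
    (hf : ∀ x ∈ Hyp H, f x ∈ Hyp H)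
    (hpow : ∀ x ∈ Hyp H, ∀ y ∈ Hyp H, minkB H (f x) (f y) = (minkB H x y) ^ t)
    (hequiv : ∀ g : Oplus H, ∀ x ∈ Hyp H, f (g.1 x) = (ρ g).1 (f x)) :
    (¬ ∃ q ∈ Hyp H, ∀ g : Oplus H, (ρ g).1 q = q) ∧
    (¬ ∃ ξ : ℝ × H, ξ ≠ 0 ∧ minkB H ξ ξ = 0 ∧
        ∀ g : Oplus H, ∃ lam : ℝ, (ρ g).1 ξ = lam • ξ) ∧
    (¬ ∃ P : Submodule ℝ (ℝ × H), Module.finrank ℝ P = 2 ∧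
        ((P : Set (ℝ × H)) ∩ Hyp H).Nonempty ∧
        ∀ g : Oplus H, ∀ v ∈ P, (ρ g).1 v ∈ P) := by
  have hnt : Nontrivial H := by
    by_contra hc
    rw [not_nontrivial_iff_subsingleton] at hc
    exact hinf inferInstance
  have hne {q : ℝ × H} (hq : q ∈ Hyp H) : q ≠ 0 := by
    rintro rfl
    exact hq.2.ne' rfl
  have main (q : ℝ × H) (hq : q ≠ 0) (hqq : 0 ≤ minkB H q q)
      (hfix : ∀ g : Oplus H, ∀ n ∈ Hyp H, (ρ g).1 n = n → (ρ g).1 ((ρ g).1 q) = q) : False := by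
    obtain ⟨x, hx, y, hy, hxy⟩ := exists_minkB_ne ht0 hf hpow hq hqq
    obtain ⟨g, m, hm, hgm, rfl⟩ := exists_sq_apply_eq hinf hx hy
    apply hxy
    have hq2 := hfix g (f m) (hf m hm) (by rw [← hequiv g m hm, hgm])
    rw [hequiv g _ ((g.2.2 x).1 hx), hequiv g x hx]
    conv_rhs => rw [← hq2, (ρ g).2.1, (ρ g).2.1]
  refine ⟨?_, ?_, ?_⟩
  · rintro ⟨q, hq, hfix⟩
    exact main q (hne hq) (by rw [hq.1]; norm_num) fun g _ _ _ => by rw [hfix, hfix]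
  · rintro ⟨ξ, hξ, hξξ, hlam⟩
    refine main ξ hξ hξξ.ge fun g n hn hgn => ?_
    obtain ⟨lam, hlam⟩ := hlam g
    have hnξ : minkB H ξ n ≠ 0 := fun h => (minkB_self_neg hn hξ h).ne hξξ
    have h1 : lam = 1 := by
      have h := (ρ g).2.1 ξ n
      rw [hgn, hlam, minkB_smul_left] at h
      exact mul_right_cancel₀ hnξ (by linarith)
    rw [hlam, h1, one_smul, hlam, h1, one_smul]
  · rintro ⟨P, hP, ⟨q, hqP, hq⟩, hinv⟩
    exact main q (hne hq) (by rw [hq.1]; norm_num) fun g n hn hgn =>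
      apply_apply_eq_of_plane (T := (ρ g).1.toLinearEquiv.toLinearMap) (ρ g).2.1 hP (hinv g)
        hn hgn hqP hq
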